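/- Assume p = 2 and that F is locally-APN, and let c ∈ K with c^{2^m} ≠ c (i.e., c ∉ F_{2^m}). Then the equation y^d + (y+c)^d + (y+1)^d + (y+c+1)^d = 0 has no solution y ∈ K. Furthermore, if instead c ∈ F_{2^m} with c ≠ 0 and c ≠ 1, then the solution set of this equation is exactly the subfield F_{2^m}. -/

import Mathlib

lemma key4 {K : Type} [Field K] [Fintype K] [CharP K 2] (d : ℕ)
    (H : ∀ b : K, b ^ 2 ≠ b → Nat.card {x : K // (x + 1) ^ d + x ^ d = b} ≤ 2)
    (x1 x2 x3 x4 a B : K) (ha : a ≠ 0) (h12 : x1 + x2 = a) (h34 : x3 + x4 = a)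
    (h13 : x1 ≠ x3) (h23 : x2 ≠ x3)
    (hB1 : x1 ^ d + x2 ^ d = B) (hB2 : x3 ^ d + x4 ^ d = B) : B = 0 ∨ B = a ^ d := by
  have h2 : (2 : K) = 0 := CharTwo.two_eq_zero
  by_contra hcon
  push Not at hcon
  have had : a ^ d ≠ 0 := pow_ne_zero _ ha
  have hb : (B / a ^ d) ^ 2 ≠ B / a ^ d := by
    intro h
    have : (B / a ^ d) * (B / a ^ d - 1) = 0 := by linear_combination h
    rcases mul_eq_zero.1 this with h | h
    · rcases div_eq_zero_iff.1 h with h | h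
      · exact hcon.1 h
      · exact had h
    · apply hcon.2
      have h' := sub_eq_zero.1 h
      field_simp at h'
      exact h'
  have hx2 : x2 = x1 + a := by linear_combination h12 - x1 * h2
  have hx4 : x4 = x3 + a := by linear_combination h34 - x3 * h2
  have sol : ∀ x : K, x ^ d + (x + a) ^ d = B → (x / a + 1) ^ d + (x / a) ^ d = B / a ^ d := by
    intro x hx
    have : x / a + 1 = (x + a) / a := by field_simp
    rw [this, div_pow, div_pow, ← hx]; ring
  have hs1 := sol x1 (by rw [← hx2]; exact hB1)
  have hs3 := sol x3 (by rw [← hx4]; exact hB2)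
  have hs2 := sol x2 (by
    have : x2 + a = x1 := by linear_combination hx2 + a * h2
    rw [this, add_comm]; exact hB1)
  have hc := H _ hb
  classical
  rw [Nat.card_eq_fintype_card] at hc
  have : 2 < Fintype.card {x : K // (x + 1) ^ d + x ^ d = B / a ^ d} := by
    rw [Fintype.two_lt_card_iff]
    refine ⟨⟨_, hs1⟩, ⟨_, hs2⟩, ⟨_, hs3⟩, ?_, ?_, ?_⟩
    · intro h
      have h := congrArg Subtype.val h
      have h := (div_left_inj' ha).1 h
      apply ha
      linear_combination -h - hx2
    · intro h
      exact h13 ((div_left_inj' ha).1 (congrArg Subtype.val h))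
    · intro h
      exact h23 ((div_left_inj' ha).1 (congrArg Subtype.val h))
  omega

lemma keyA {K : Type} [Field K] [Fintype K] [CharP K 2] (d q : ℕ)
    (H : ∀ b : K, b ^ 2 ≠ b → Nat.card {x : K // (x + 1) ^ d + x ^ d = b} ≤ 2)
    (H' : ¬ ∀ x : K, (x + 1) ^ d + x ^ d = 1)
    (hadd : ∀ x y : K, (x + y) ^ q = x ^ q + y ^ q) (hinv : ∀ x : K, (x ^ q) ^ q = x)
    (hfix : ∀ x : K, x ^ q = x → x ^ d = x)
    (y : K) (hy : (y + 1) ^ d + y ^ d = 1) : y ^ q = y := by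
  have h2 : (2 : K) = 0 := CharTwo.two_eq_zero
  by_contra hyq
  by_cases hf : (y ^ d) ^ q = y ^ d
  · have hN : ∀ x : K, (x ^ d) ^ q = x ^ d → (x ^ d) ^ 2 = x * x ^ q := by
      intro x hx
      have h1 : (x * x ^ q) ^ d = x * x ^ q := by
        apply hfix; rw [mul_pow, hinv, mul_comm]
      rw [← h1, mul_pow, ← pow_mul x q, mul_comm q, pow_mul, hx, sq]
    have hy1 : (y + 1) ^ d = 1 + y ^ d := by linear_combination hy - y ^ d * h2
    have e1 := hN y hf
    have e2 := hN (y + 1) (by rw [hy1, hadd, hf, one_pow])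
    rw [hy1, hadd, one_pow] at e2
    apply hyq
    linear_combination e1 - e2 + (y ^ d - y) * h2
  · have hsub : ∀ x z : K, x ^ q = x → z ^ q = z → (x + z) ^ q = x + z := by
      intro x z hx hz; rw [hadd, hx, hz]
    have hind : ∀ t : K, t ^ q ≠ t → ∀ l u : K, l ^ q = l → u ^ q = u → l + u * t = 0 → u = 0 := by
      intro t ht l u hl hu h
      by_contra hu0
      have h' := congrArg (fun x => x ^ q) h
      have hq0 : (0 : K) ^ q = 0 := by
        have := hadd 0 0
        simp only [add_zero] at this
        linear_combination -this
      simp only [hadd, mul_pow, hl, hu, hq0] at h'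
      apply ht
      apply mul_left_cancel₀ hu0
      linear_combination h' - h
    have hmul : ∀ l x : K, l ^ q = l → (l * x) ^ d = l * x ^ d := by
      intro l x hl; rw [mul_pow, hfix l hl]
    have hL : ∀ l u : K, l ^ q = l → u ^ q = u → (l + u * y) ^ d = l + u * y ^ d := by
      intro l u hl hu
      by_cases hl0 : l = 0
      · subst hl0; simp [hmul u y hu]
      by_cases hu0 : u = 0
      · subst hu0; simp [hfix l hl]
      have ha : l + u * y ≠ 0 := fun h => hu0 (hind y hyq l u hl hu h)
      have hLa : l + u * y ^ d ≠ 0 := fun h => hu0 (hind _ hf l u hl hu h)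
      have hy0 : y ≠ 0 := by
        intro h; subst h
        exact ha (by_contra fun _ => hyq (by
          have := hadd 0 0
          simp only [add_zero] at this
          linear_combination -this))
      have := key4 d H l (u * y) (l * (y + 1)) ((u + l) * y) (l + u * y) (l + u * y ^ d) ha rfl
        (by linear_combination l * y * h2) (by
          intro h
          have : l * y = 0 := by linear_combination -h
          exact (mul_ne_zero hl0 hy0) this) (by
          intro h
          have h3 := hind y hyq l (l + u) hl (hsub _ _ hl hu) (by
            linear_combination -h + (u * y) * h2)
          have : l = 0 := by linear_combination -h - y * h3 + (u * y) * h2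
          exact hl0 this)
        (by rw [hfix l hl, hmul u y hu])
        (by
          rw [hmul l _ hl, hmul _ y (hsub _ _ hu hl)]
          linear_combination l * hy)
      rcases this with h | h
      · exact absurd h hLa
      · exact h.symm
    apply H'
    have htr : y + y ^ q ≠ 0 := by
      intro h; apply hyq; linear_combination h - y * h2
    intro x
    obtain ⟨u, hu, hu'⟩ : ∃ u : K, u ^ q = u ∧ u * (y + y ^ q) = x + x ^ q := by
      refine ⟨(x + x ^ q) / (y + y ^ q), ?_, div_mul_cancel₀ _ htr⟩
      rw [div_pow, hadd, hadd, hinv, hinv, add_comm x, add_comm y]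
    have hl : (x + u * y) ^ q = x + u * y := by
      rw [hadd, mul_pow, hu]
      linear_combination -hu' + (u * y ^ q - x) * h2
    have e1 := hL (x + u * y) u hl hu
    have e2 := hL (x + u * y + 1) u (hsub _ _ hl (one_pow _)) hu
    have t1 : x + u * y + u * y = x := by linear_combination u * y * h2
    have t2 : x + u * y + 1 + u * y = x + 1 := by linear_combination u * y * h2
    rw [t1] at e1
    rw [t2] at e2
    rw [e1, e2]
    linear_combination (x + u * y + u * y ^ d) * h2

lemma keyB {K : Type} [Field K] [Fintype K] [CharP K 2] (d q : ℕ)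
    (H : ∀ b : K, b ^ 2 ≠ b → Nat.card {x : K // (x + 1) ^ d + x ^ d = b} ≤ 2)
    (H' : ¬ ∀ x : K, (x + 1) ^ d + x ^ d = 1)
    (hadd : ∀ x y : K, (x + y) ^ q = x ^ q + y ^ q) (hinv : ∀ x : K, (x ^ q) ^ q = x)
    (hfix : ∀ x : K, x ^ q = x → x ^ d = x)
    (z w : K) (hz : z ^ d = 1) (hw : w ^ d = 1) (hzq : z ^ q * z = 1) (hwq : w ^ q * w = 1)
    (hz1 : z ≠ 1) (hw1 : w ≠ 1) (hzw : z ≠ w) (hzw1 : z * w ≠ 1) : False := by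
  have h2 : (2 : K) = 0 := CharTwo.two_eq_zero
  have hz0 : z ≠ 0 := right_ne_zero_of_mul_eq_one hzq
  have hw0 : w ≠ 0 := right_ne_zero_of_mul_eq_one hwq
  have hmul : ∀ l x : K, l ^ q = l → (l * x) ^ d = l * x ^ d := by
    intro l x hl; rw [mul_pow, hfix l hl]
  set Z := z ^ q with hZ
  set W := w ^ q with hW
  have hZd : Z ^ d = 1 := by rw [hZ, ← pow_mul, mul_comm, pow_mul, hz, one_pow]
  have hWd : W ^ d = 1 := by rw [hW, ← pow_mul, mul_comm, pow_mul, hw, one_pow]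
  have hl : (w + W) ^ q = w + W := by rw [hadd, hW, hinv, add_comm]
  have hu : (z + Z) ^ q = z + Z := by rw [hadd, hZ, hinv, add_comm]
  have sq1 : ∀ t : K, t * t = 1 → t = 1 := by
    intro t ht
    have : (t - 1) * (t - 1) = 0 := by linear_combination ht - (t - 1) * h2
    exact sub_eq_zero.1 (mul_self_eq_zero.1 this)
  have hl0 : w + W ≠ 0 := by
    intro h; apply hw1; apply sq1; linear_combination w * h - hwq - h2
  have hu0 : z + Z ≠ 0 := by
    intro h; apply hz1; apply sq1; linear_combination z * h - hzq - h2
  -- (w+W) + (z+Z) ≠ 0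
  have hsum : (w + W) + (z + Z) ≠ 0 := by
    intro h
    have : (z + w) * (z * w + 1) = 0 := by
      linear_combination (z * w) * h - z * hwq - w * hzq
    rcases mul_eq_zero.1 this with h | h
    · exact hzw (by linear_combination h - w * h2)
    · exact hzw1 (by linear_combination h - h2)
  -- independence
  have hindep : ∀ l u : K, l ≠ 0 → l ^ q = l → u ^ q = u → l * z = u * w → False := by
    intro l u hl0 hl hu h
    have h' := congrArg (fun x => x ^ q) h
    simp only [mul_pow, hl, hu, ← hZ, ← hW] at h'
    -- l Z = u W ; l z = u w; u = l z W , l Z = l z W W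
    have e : u = l * z * W := by linear_combination (-W) * h - u * hwq
    have e2 : l * (z * W) * (z * W) = l := by
      linear_combination (-z * W) * e - z * h' + l * hzq + 0 * h2
    have e3 : (z * W) * (z * W) = 1 := by
      apply mul_left_cancel₀ hl0; linear_combination e2
    have e4 := sq1 _ e3
    apply hzw
    linear_combination w * e4 - z * hwq
  have ha : (w + W) * z + (z + Z) * w ≠ 0 := by
    intro h
    exact hindep _ _ hl0 hl hu (by linear_combination h - (z + Z) * w * h2)
  have := key4 d H ((w + W) * z) ((z + Z) * w) ((w + W) * Z) ((z + Z) * W) _ ((w + W) + (z + Z))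
    ha rfl (by linear_combination (W * Z - w * z) * h2)
    (by
      intro h
      have := mul_left_cancel₀ hl0 h
      exact hu0 (by rw [← this]; linear_combination z * h2))
    (by
      intro h
      apply hzw1
      apply sq1
      have h' := congrArg (fun x => x ^ q) h
      have hZq : Z ^ q = z := hinv z
      simp only [mul_pow, hl, hu, ← hW, hZq] at h'
      apply mul_left_cancel₀ hl0
      linear_combination (-w * w * z) * h' + z * h + (z + Z) * (w * z) * hwq + (w + W) * hzq)
    (by rw [hmul _ _ hl, hmul _ _ hu, hz, hw]; ring)
    (by rw [hmul _ _ hl, hmul _ _ hu, hZd, hWd]; ring)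
  rcases this with h | h
  · exact hsum h
  · have hlz0 : (w + W) * z ≠ 0 := mul_ne_zero hl0 hz0
    have hF : ((w + W) * z) ^ d = w + W := by rw [hmul _ _ hl, hz, mul_one]
    have hG : ((z + Z) * w) ^ d = z + Z := by rw [hmul _ _ hu, hw, mul_one]
    have hA := keyA d q H H' hadd hinv hfix ((z + Z) * w / ((w + W) * z)) (by
      have : (z + Z) * w / ((w + W) * z) + 1 = ((w + W) * z + (z + Z) * w) / ((w + W) * z) := by
        field_simp; ring
      rw [this, div_pow, div_pow, ← h, hF, hG]
      field_simp
      linear_combination (z + Z) * h2)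
    exact hindep ((z + Z) * w / ((w + W) * z) * (w + W)) (z + Z)
      (mul_ne_zero (div_ne_zero (mul_ne_zero hu0 hw0) hlz0) hl0)
      (by rw [mul_pow, hA, hl]) hu (by field_simp)

/-- for a locally-APN Niho power function
`F(x) = x^(s(2^m-1)+1)` over `K = GF(2^(2m))`: if `c ∉ F_{2^m}` then
`y^d + (y+c)^d + (y+1)^d + (y+c+1)^d = 0` has no solution `y ∈ K`; if
`c ∈ F_{2^m}`, `c ≠ 0`, `c ≠ 1`, then its solution set is exactly `F_{2^m}`. -/
theorem stmt_17 (m s : ℕ) (hm : 0 < m) (hs : 0 < s)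
    (K : Type) [Field K] [Fintype K] (hK : Fintype.card K = 2 ^ (2 * m))
    (d : ℕ) (hd : d = s * (2 ^ m - 1) + 1)
    (hAPN : sSup {k : ℕ | ∃ b : K, b ^ 2 ≠ b ∧
        Nat.card {x : K // (x + 1) ^ d + x ^ d = b} = k} = 2) :
    (∀ c : K, c ^ (2 ^ m) ≠ c →
      ∀ y : K, y ^ d + (y + c) ^ d + (y + 1) ^ d + (y + c + 1) ^ d ≠ 0) ∧
    (∀ c : K, c ^ (2 ^ m) = c → c ≠ 0 → c ≠ 1 →
      {y : K | y ^ d + (y + c) ^ d + (y + 1) ^ d + (y + c + 1) ^ d = 0}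
        = {y : K | y ^ (2 ^ m) = y}) := by
  classical
  have : Fact (Nat.Prime 2) := ⟨Nat.prime_two⟩
  have : CharP K 2 := charP_of_card_eq_prime_pow (f := 2 * m) (by rw [hK])
  have h2 : (2 : K) = 0 := CharTwo.two_eq_zero
  have hbdd : BddAbove {k : ℕ | ∃ b : K, b ^ 2 ≠ b ∧
        Nat.card {x : K // (x + 1) ^ d + x ^ d = b} = k} := by
    refine ⟨Nat.card K, ?_⟩
    rintro k ⟨b, -, rfl⟩
    exact Nat.card_le_card_of_injective _ Subtype.val_injective
  have H : ∀ b : K, b ^ 2 ≠ b → Nat.card {x : K // (x + 1) ^ d + x ^ d = b} ≤ 2 := by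
    intro b hb
    rw [← hAPN]
    exact le_csSup hbdd ⟨b, hb, rfl⟩
  have H' : ¬ ∀ x : K, (x + 1) ^ d + x ^ d = 1 := by
    intro hall
    have : sSup {k : ℕ | ∃ b : K, b ^ 2 ≠ b ∧
        Nat.card {x : K // (x + 1) ^ d + x ^ d = b} = k} ≤ 0 := by
      apply csSup_le'
      rintro k ⟨b, hb, rfl⟩
      have : IsEmpty {x : K // (x + 1) ^ d + x ^ d = b} := by
        refine ⟨fun x => hb ?_⟩
        rw [← x.2, hall, one_pow]
      simp
    omega
  obtain ⟨r, hr⟩ : ∃ r, 2 ^ m = r + 1 := ⟨2 ^ m - 1, by have := Nat.one_le_two_pow (n := m); omega⟩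
  have hadd : ∀ x y : K, (x + y) ^ (2 ^ m) = x ^ (2 ^ m) + y ^ (2 ^ m) := fun x y =>
    add_pow_char_pow x y 2 m
  have hinv : ∀ x : K, (x ^ (2 ^ m)) ^ (2 ^ m) = x := by
    intro x
    rw [← pow_mul, ← pow_add, ← two_mul, ← hK, FiniteField.pow_card]
  rw [hr] at hd hadd hinv ⊢
  rw [Nat.add_sub_cancel] at hd
  have hfix : ∀ x : K, x ^ (r + 1) = x → x ^ d = x := by
    intro x hx
    by_cases h0 : x = 0
    · subst h0; rw [hd]; simp
    · have : x ^ r = 1 := by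
        apply mul_right_cancel₀ h0
        rw [← pow_succ, hx, one_mul]
      rw [hd, pow_succ, mul_comm s, pow_mul, this, one_pow, one_mul]
  have hU : ∀ z : K, z ^ d = 1 → z ^ (r + 1) * z = 1 := by
    intro z hz
    have hz0 : z ≠ 0 := by
      rintro rfl
      rw [hd] at hz; simp at hz
    have h1 : z ^ (r * (r + 2)) = 1 := by
      apply mul_right_cancel₀ hz0
      rw [← pow_succ, one_mul]
      have := hinv z
      rw [← pow_mul] at this
      convert this using 2; ring
    have h3 : (z ^ d) ^ (r + 2) = 1 := by rw [hz, one_pow]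
    rw [← pow_succ, ← h3, hd, ← pow_mul]
    have : (s * r + 1) * (r + 2) = (r * (r + 2)) * s + (r + 1 + 1) := by ring
    rw [this, pow_add z (r * (r + 2) * s), pow_mul z _ s, h1, one_pow, one_mul]
  have hA := keyA d (r + 1) H H' hadd hinv hfix
  have hd0 : d ≠ 0 := by omega
  -- the case of derivative zero
  have hZ : ∀ y : K, (y + 1) ^ d + y ^ d = 0 → y ≠ 0 ∧ ((y + 1) / y) ^ d = 1 := by
    intro y h
    have hy0 : y ≠ 0 := by
      rintro rfl
      rw [zero_pow hd0] at h; simp at h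
    refine ⟨hy0, ?_⟩
    rw [div_pow, div_eq_one_iff_eq (pow_ne_zero _ hy0)]
    linear_combination h - y ^ d * h2
  have hTr : ∀ y : K, (y + 1) ^ d + y ^ d = 0 → y ^ (r + 1) + y = 1 := by
    intro y h
    obtain ⟨hy0, hz⟩ := hZ y h
    have := hU _ hz
    have hyq : y ^ (r + 1) ≠ 0 := pow_ne_zero _ hy0
    rw [div_pow, hadd, one_pow, div_mul_div_comm, div_eq_one_iff_eq (mul_ne_zero hyq hy0)] at this
    linear_combination this - h2
  have hone : ∀ c : K, c ≠ 0 → c ≠ 1 → ∀ y : K,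
      y ^ d + (y + c) ^ d + (y + 1) ^ d + (y + c + 1) ^ d = 0 →
      ((y + 1) ^ d + y ^ d = 0 ∧ (y + c + 1) ^ d + (y + c) ^ d = 0) ∨
      ((y + 1) ^ d + y ^ d = 1 ∧ (y + c + 1) ^ d + (y + c) ^ d = 1) := by
    intro c hc0 hc1 y h
    have e : (y + c + 1) ^ d + (y + c) ^ d = (y + 1) ^ d + y ^ d := by
      linear_combination h - ((y + 1) ^ d + y ^ d) * h2
    have := key4 d H (y + 1) y (y + c + 1) (y + c) 1 _ one_ne_zero
      (by linear_combination y * h2) (by linear_combination (y + c) * h2)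
      (by intro h; apply hc0; linear_combination -h)
      (by intro h; apply hc1; linear_combination -h - h2) rfl e
    rw [e]
    rw [one_pow] at this
    tauto
  refine ⟨?_, ?_⟩
  · intro c hc y h
    have hc0 : c ≠ 0 := by rintro rfl; exact hc (by simp)
    have hc1 : c ≠ 1 := by rintro rfl; exact hc (by simp)
    apply hc
    rcases hone c hc0 hc1 y h with ⟨h1, h3⟩ | ⟨h1, h3⟩
    · have a1 := hTr _ h1
      have a2 := hTr _ h3
      rw [hadd] at a2
      linear_combination a2 - a1 - c * h2
    · have a1 := hA _ h1
      have a2 := hA _ h3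
      rw [hadd] at a2
      linear_combination a2 - a1
  · intro c hc hc0 hc1
    ext y
    simp only [Set.mem_setOf_eq]
    constructor
    · intro h
      rcases hone c hc0 hc1 y h with ⟨h1, h3⟩ | ⟨h1, h3⟩
      · exfalso
        obtain ⟨hy0, hz⟩ := hZ _ h1
        obtain ⟨hyc0, hw⟩ := hZ _ h3
        refine keyB d (r + 1) H H' hadd hinv hfix _ _ hz hw (hU _ hz) (hU _ hw) ?_ ?_ ?_ ?_
        · intro h
          rw [div_eq_one_iff_eq hy0] at h
          simp at h
        · intro h
          rw [div_eq_one_iff_eq hyc0] at h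
          simp at h
        · intro h
          rw [div_eq_div_iff hy0 hyc0] at h
          apply hc0
          linear_combination h
        · intro h
          rw [div_mul_div_comm, div_eq_one_iff_eq (mul_ne_zero hy0 hyc0)] at h
          apply hc1
          linear_combination h - (y + 1) * h2
      · exact hA _ h1
    · intro h
      have hy1 : (y + 1) ^ (r + 1) = y + 1 := by rw [hadd, h, one_pow]
      have hyc : (y + c) ^ (r + 1) = y + c := by rw [hadd, h, hc]
      have hyc1 : (y + c + 1) ^ (r + 1) = y + c + 1 := by rw [hadd, hyc, one_pow]
      rw [hfix _ h, hfix _ hy1, hfix _ hyc, hfix _ hyc1]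
      linear_combination (2 * y + c + 1) * h2
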